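/- arXiv:2007.13581 — 2 statements merged into one kernel-verified Lean document; each statement's English description precedes it below -/
import Mathlib

section
/- Let 1 < α < 2, β > 0 and let μ satisfy πα/2 < μ < π. Then there exists a constant C = C(α,β,μ) > 0 such that for every complex number z with μ ≤ |arg(z)| ≤ π one has |E_{α,β}(z)| ≤ C/(1+|z|). -/
open Complex Real

/-- The Mittag–Leffler function `E_{α,β}(z) = Σ_{k=0}^∞ z^k / Γ(αk + β)`. -/
noncomputable def mittagLeffler (α β : ℝ) (z : ℂ) : ℂ :=
  ∑' k : ℕ, z ^ k / Complex.Gamma ((α * k + β : ℝ) : ℂ)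

open MeasureTheory Set Filter Topology

/-- The integral of `f` along the boundary of the half-strip `{w | X ≤ re w, |im w| ≤ δ}`, traversed
from `∞ - δ i` to `∞ + δ i`; the image of this path under `exp` is a Hankel contour. -/
noncomputable def hankelIntegral (f : ℂ → ℂ) (δ X : ℝ) : ℂ :=
  (∫ x : ℝ in Ioi X, f (x + δ * I)) - (∫ x : ℝ in Ioi X, f (x + (-δ : ℝ) * I))
    + I * ∫ y in (-δ)..δ, f (X + y * I)

/-- The integrand of Hankel's formula for `1 / Γ(s)` in logarithmic coordinates `ζ = exp w`. -/
noncomputable def hankelKernel (s : ℝ) (w : ℂ) : ℂ :=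
  cexp (cexp w + (1 - s : ℝ) * w)

lemma exp_mul_neg_add_le {c : ℝ} (hc : 0 < c) (a : ℝ) {x : ℝ} (hx : 0 ≤ x) :
    rexp (rexp x * (-c) + a * x) ≤ rexp ((a + 1) ^ 2 / (2 * c)) * rexp (-x) := by
  rw [← Real.exp_add, Real.exp_le_exp]
  have h := Real.quadratic_le_exp_of_nonneg hx
  have h1 : rexp x * c ≥ x ^ 2 / 2 * c := by nlinarith
  have h2 : (a + 1) ^ 2 / (2 * c) - (a + 1) * x + x ^ 2 / 2 * c
      = (a + 1 - c * x) ^ 2 / (2 * c) := by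
    field_simp
    ring
  have h3 : 0 ≤ (a + 1 - c * x) ^ 2 / (2 * c) := by positivity
  linarith

lemma integrableOn_exp_exp {c : ℝ} (hc : 0 < c) (a X : ℝ) :
    IntegrableOn (fun x : ℝ => rexp (rexp x * (-c) + a * x)) (Ioi X) := by
  refine integrable_of_isBigO_exp_neg one_pos (by fun_prop) ?_
  refine Asymptotics.IsBigO.of_bound (rexp ((a + 1) ^ 2 / (2 * c))) ?_
  filter_upwards [eventually_ge_atTop 0] with x hx
  rw [Real.norm_of_nonneg (Real.exp_pos _).le, Real.norm_of_nonneg (Real.exp_pos _).le]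
  simpa using exp_mul_neg_add_le hc a hx

lemma tendsto_exp_exp {c : ℝ} (hc : 0 < c) (a : ℝ) :
    Tendsto (fun x : ℝ => rexp (rexp x * (-c) + a * x)) atTop (𝓝 0) := by
  refine squeeze_zero' (Eventually.of_forall fun x => (Real.exp_pos _).le)
    ((eventually_ge_atTop 0).mono fun x hx => exp_mul_neg_add_le hc a hx) ?_
  simpa using Real.tendsto_exp_neg_atTop_nhds_zero.const_mul (rexp ((a + 1) ^ 2 / (2 * c)))

lemma norm_hankelKernel (s x y : ℝ) :
    ‖hankelKernel s (x + y * I)‖ = rexp (rexp x * Real.cos y + (1 - s) * x) := by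
  rw [hankelKernel, Complex.norm_exp]
  congr 1
  simp [Complex.exp_re, -ofReal_sub]

lemma differentiable_hankelKernel (s : ℝ) : Differentiable ℂ (hankelKernel s) := by
  unfold hankelKernel
  fun_prop

lemma continuous_hankelKernel (s : ℝ) : Continuous (hankelKernel s) :=
  (differentiable_hankelKernel s).continuous

lemma integrableOn_hankelKernel (s X : ℝ) {y : ℝ} (hy : Real.cos y < 0) :
    IntegrableOn (fun x : ℝ => hankelKernel s (x + y * I)) (Ioi X) := by
  refine (integrableOn_exp_exp (neg_pos.2 hy) (1 - s) X).mono' ?_ ?_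
  · exact ((continuous_hankelKernel s).comp (by fun_prop)).aestronglyMeasurable
  · exact Eventually.of_forall fun x => by rw [norm_hankelKernel, neg_neg]

lemma tendsto_hankelKernel (s : ℝ) {y : ℝ} (hy : Real.cos y < 0) :
    Tendsto (fun x : ℝ => hankelKernel s (x + y * I)) atTop (𝓝 0) := by
  rw [tendsto_zero_iff_norm_tendsto_zero]
  simpa [norm_hankelKernel] using tendsto_exp_exp (neg_pos.2 hy) (1 - s)

/-- The left edge of the Hankel path may be moved across a region of holomorphy. -/
lemma hankelIntegral_eq_of_differentiableOn {f : ℂ → ℂ} {δ X Y : ℝ} (hXY : X ≤ Y)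
    (hf : DifferentiableOn ℂ f (uIcc X Y ×ℂ uIcc (-δ) δ))
    (hu : IntegrableOn (fun x : ℝ => f (x + δ * I)) (Ioi X))
    (hl : IntegrableOn (fun x : ℝ => f (x + (-δ : ℝ) * I)) (Ioi X)) :
    hankelIntegral f δ X = hankelIntegral f δ Y := by
  have key := Complex.integral_boundary_rect_eq_zero_of_differentiableOn f (X + (-δ : ℝ) * I)
    (Y + δ * I) (by simpa using hf)
  have h1 := intervalIntegral.integral_Ioi_sub_Ioi hu hXY
  have h2 := intervalIntegral.integral_Ioi_sub_Ioi hl hXY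
  simp only [add_re, ofReal_re, mul_re, I_re, mul_zero, ofReal_im, I_im, mul_one, sub_self,
    add_zero, add_im, mul_im, zero_add, smul_eq_mul] at key
  unfold hankelIntegral
  linear_combination h1 - h2 - key

lemma hankelIntegral_hankelKernel_eq (s : ℝ) {δ : ℝ} (hδ : Real.cos δ < 0) (X Y : ℝ) :
    hankelIntegral (hankelKernel s) δ X = hankelIntegral (hankelKernel s) δ Y := by
  wlog h : X ≤ Y generalizing X Y
  · exact (this Y X (le_of_not_ge h)).symm
  · exact hankelIntegral_eq_of_differentiableOn h (differentiable_hankelKernel s).differentiableOn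
      (integrableOn_hankelKernel s X hδ) (integrableOn_hankelKernel s X (by rwa [Real.cos_neg]))

/-- Rotating a ray of the Hankel path inside the left half-plane. -/
lemma integral_ray_hankelKernel_sub (s : ℝ) {a b c : ℝ} (hab : a ≤ b) (hc : 0 < c)
    (h : ∀ y ∈ Icc a b, Real.cos y ≤ -c) :
    (∫ x : ℝ in Ioi 0, hankelKernel s (x + a * I)) - (∫ x : ℝ in Ioi 0, hankelKernel s (x + b * I))
      = I * ∫ y in a..b, hankelKernel s ((0 : ℝ) + y * I) := by
  have ha := h a (left_mem_Icc.2 hab)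
  have hb := h b (right_mem_Icc.2 hab)
  have key (X : ℝ) := Complex.integral_boundary_rect_eq_zero_of_differentiableOn (hankelKernel s)
    ((0 : ℝ) + a * I) (X + b * I) (differentiable_hankelKernel s).differentiableOn
  simp only [add_re, ofReal_re, mul_re, I_re, mul_zero, ofReal_im, I_im, mul_one, sub_self,
    add_zero, add_im, mul_im, zero_add, smul_eq_mul] at key
  have hside : Tendsto (fun X : ℝ => ∫ y in a..b, hankelKernel s (X + y * I)) atTop (𝓝 0) := by
    have h0 := (tendsto_exp_exp hc (1 - s)).mul_const |b - a|
    rw [zero_mul] at h0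
    refine squeeze_zero_norm (fun X => ?_) h0
    refine intervalIntegral.norm_integral_le_of_norm_le_const fun y hy => ?_
    rw [norm_hankelKernel]
    rw [uIoc_of_le hab] at hy
    have := h y ⟨hy.1.le, hy.2⟩
    gcongr
  have l1 := intervalIntegral_tendsto_integral_Ioi 0
    (integrableOn_hankelKernel s 0 (y := a) (by linarith)) tendsto_id
  have l2 := intervalIntegral_tendsto_integral_Ioi 0
    (integrableOn_hankelKernel s 0 (y := b) (by linarith)) tendsto_id
  have l3 := ((l1.sub l2).add (hside.const_mul I)).sub_const
    (I * ∫ y in a..b, hankelKernel s ((0 : ℝ) + y * I))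
  simp only [id, key] at l3
  have := tendsto_nhds_unique l3 tendsto_const_nhds
  linear_combination this

lemma hankelIntegral_hankelKernel_eq_pi (s : ℝ) {δ : ℝ} (h1 : π / 2 < δ) (h2 : δ ≤ π) :
    hankelIntegral (hankelKernel s) δ 0 = hankelIntegral (hankelKernel s) π 0 := by
  have hpos := Real.pi_pos
  have hc : 0 < -Real.cos δ :=
    neg_pos.2 (Real.cos_neg_of_pi_div_two_lt_of_lt h1 (by linarith))
  have hup := integral_ray_hankelKernel_sub s h2 hc fun y hy => by
    rw [neg_neg]
    exact Real.cos_le_cos_of_nonneg_of_le_pi (by linarith) hy.2 hy.1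
  have hlo := integral_ray_hankelKernel_sub s (neg_le_neg h2) hc fun y hy => by
    rw [neg_neg, ← Real.cos_neg y]
    exact Real.cos_le_cos_of_nonneg_of_le_pi (by linarith) (by linarith [hy.1]) (by linarith [hy.2])
  have hi (a b : ℝ) :
      IntervalIntegrable (fun y : ℝ => hankelKernel s ((0 : ℝ) + y * I)) volume a b :=
    ((continuous_hankelKernel s).comp (by fun_prop)).intervalIntegrable a b
  have e1 := intervalIntegral.integral_add_adjacent_intervals (hi (-π) (-δ)) (hi (-δ) δ)
  have e2 := intervalIntegral.integral_add_adjacent_intervals (hi (-π) δ) (hi δ π)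
  unfold hankelIntegral
  linear_combination hup + hlo + I * e1 + I * e2

lemma hankelIntegral_hankelKernel_add_one (s : ℝ) {δ : ℝ} (hδ : Real.cos δ < 0) (X : ℝ) :
    hankelIntegral (hankelKernel s) δ X = s * hankelIntegral (hankelKernel (s + 1)) δ X := by
  have hδ' : Real.cos (-δ) < 0 := by rwa [Real.cos_neg]
  have hd (w : ℂ) : HasDerivAt (hankelKernel (s + 1))
      (hankelKernel s w - s * hankelKernel (s + 1) w) w := by
    have h : HasDerivAt (hankelKernel (s + 1)) _ w := ((Complex.hasDerivAt_exp w).add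
      ((hasDerivAt_id w).const_mul ((1 - (s + 1) : ℝ) : ℂ))).cexp
    have e : hankelKernel s w = cexp (cexp w + ((1 - (s + 1) : ℝ) : ℂ) * w) * cexp w := by
      rw [hankelKernel, ← Complex.exp_add]
      congr 1
      push_cast
      ring
    refine h.congr_deriv ?_
    rw [e, hankelKernel]
    push_cast
    simp only [Pi.add_apply, id]
    ring
  have ray {y : ℝ} (hy : Real.cos y < 0) :
      (∫ x : ℝ in Ioi X, hankelKernel s (x + y * I))
        - s * (∫ x : ℝ in Ioi X, hankelKernel (s + 1) (x + y * I))
        = - hankelKernel (s + 1) (X + y * I) := by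
    have i1 := integrableOn_hankelKernel s X hy
    have i2 := (integrableOn_hankelKernel (s + 1) X hy).const_mul (s : ℂ)
    rw [← integral_const_mul, ← integral_sub i1 i2]
    have := integral_Ioi_of_hasDerivAt_of_tendsto' (a := X)
      (f := fun x : ℝ => hankelKernel (s + 1) (x + y * I)) (fun x _ => ?_)
      (i1.sub i2) (tendsto_hankelKernel (s + 1) hy)
    · simpa using this
    · have h1 : HasDerivAt (fun x : ℝ => (x : ℂ) + y * I) 1 x := by
        simpa using (hasDerivAt_id x).ofReal_comp.add_const ((y : ℂ) * I)
      exact ((hd (x + y * I)).comp x h1).congr_deriv (mul_one _)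
  have arc : I * (∫ y in (-δ)..δ, hankelKernel s (X + y * I))
      - s * (I * ∫ y in (-δ)..δ, hankelKernel (s + 1) (X + y * I))
      = hankelKernel (s + 1) (X + δ * I) - hankelKernel (s + 1) (X + (-δ : ℝ) * I) := by
    have hi (t : ℝ) :
        IntervalIntegrable (fun y : ℝ => hankelKernel t (X + y * I)) volume (-δ) δ :=
      ((continuous_hankelKernel t).comp (by fun_prop)).intervalIntegrable _ _
    have := intervalIntegral.integral_eq_sub_of_hasDerivAt (a := -δ) (b := δ)
      (f := fun y : ℝ => hankelKernel (s + 1) (X + y * I))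
      (f' := fun y : ℝ => I * (hankelKernel s (X + y * I) - s * hankelKernel (s + 1) (X + y * I)))
      (fun y _ => ?_) (((hi s).sub ((hi (s + 1)).const_mul _)).const_mul _)
    · rw [← this, intervalIntegral.integral_const_mul,
        intervalIntegral.integral_sub (hi s) ((hi (s + 1)).const_mul _),
        intervalIntegral.integral_const_mul]
      ring
    · have h1 : HasDerivAt (fun y : ℝ => (X : ℂ) + y * I) I y := by
        simpa using ((hasDerivAt_id y).ofReal_comp.mul_const I).const_add (X : ℂ)
      exact ((hd (X + y * I)).comp y h1).congr_deriv (mul_comm _ _)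
  have r1 := ray hδ
  have r2 := ray hδ'
  unfold hankelIntegral
  linear_combination r1 - r2 + arc

lemma integrable_and_integral_exp_neg_exp {a : ℝ} (ha : 0 < a) :
    Integrable (fun x : ℝ => rexp (-rexp x + a * x)) ∧
      ∫ x : ℝ, rexp (-rexp x + a * x) = Real.Gamma a := by
  have hd : ∀ x ∈ (univ : Set ℝ), HasDerivWithinAt rexp (rexp x) univ x :=
    fun x _ => (Real.hasDerivAt_exp x).hasDerivWithinAt
  have hinj : InjOn rexp univ := Real.exp_injective.injOn
  have himg : rexp '' univ = Ioi 0 := by rw [image_univ, Real.range_exp]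
  have hg (x : ℝ) : |rexp x| • (rexp (-rexp x) * rexp x ^ (a - 1)) = rexp (-rexp x + a * x) := by
    rw [abs_of_pos (Real.exp_pos x), ← Real.exp_mul, smul_eq_mul, ← Real.exp_add, ← Real.exp_add]
    ring_nf
  have h1 := integrableOn_image_iff_integrableOn_abs_deriv_smul MeasurableSet.univ hd hinj
    (fun x => rexp (-x) * x ^ (a - 1))
  have h2 := integral_image_eq_integral_abs_deriv_smul MeasurableSet.univ hd hinj
    (fun x => rexp (-x) * x ^ (a - 1))
  simp only [himg, hg, integrableOn_univ, setIntegral_univ] at h1 h2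
  exact ⟨h1.1 (Real.GammaIntegral_convergent ha), by rw [← h2, Real.Gamma_eq_integral ha]⟩

lemma hankelIntegral_hankelKernel_pi (s X : ℝ) :
    hankelIntegral (hankelKernel s) π X
      = 2 * I * Real.sin (π * s) * (∫ x : ℝ in Ioi X, rexp (-rexp x + (1 - s) * x) : ℝ)
        + I * ∫ y in (-π)..π, hankelKernel s (X + y * I) := by
  have hup (x : ℝ) : hankelKernel s (x + π * I)
      = cexp ((1 - s : ℝ) * (π * I)) * (rexp (-rexp x + (1 - s) * x) : ℝ) := by
    rw [hankelKernel, ofReal_exp, ← Complex.exp_add, Complex.exp_add (x : ℂ), Complex.exp_pi_mul_I]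
    congr 1
    push_cast
    ring
  have hlo (x : ℝ) : hankelKernel s (x + (-π : ℝ) * I)
      = cexp (-((1 - s : ℝ) * (π * I))) * (rexp (-rexp x + (1 - s) * x) : ℝ) := by
    have : cexp ((-π : ℝ) * I) = -1 := by
      rw [ofReal_neg, neg_mul, Complex.exp_neg, Complex.exp_pi_mul_I]
      norm_num
    rw [hankelKernel, ofReal_exp, ← Complex.exp_add, Complex.exp_add (x : ℂ), this]
    congr 1
    push_cast
    ring
  have hsin : (Real.sin (π * s) : ℂ) = Complex.sin ((1 - s : ℝ) * π) := by
    rw [← ofReal_mul, ← ofReal_sin, ← Real.sin_pi_sub]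
    ring_nf
  have h2 : cexp ((1 - s : ℝ) * (π * I)) - cexp (-((1 - s : ℝ) * (π * I)))
      = 2 * I * Real.sin (π * s) := by
    rw [hsin, Complex.sin, ← mul_assoc, ← neg_mul]
    linear_combination (cexp (((1 - s : ℝ) : ℂ) * π * I) - cexp (-(((1 - s : ℝ) : ℂ) * π) * I)) * I_sq
  unfold hankelIntegral
  simp only [hup, hlo, integral_const_mul, integral_complex_ofReal]
  rw [← h2]
  ring

lemma hankelIntegral_hankelKernel_pi_of_lt_one {s : ℝ} (hs0 : 0 < s) (hs : s < 1) :
    hankelIntegral (hankelKernel s) π 0 = 2 * π * I / Complex.Gamma s := by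
  obtain ⟨hint, hval⟩ := integrable_and_integral_exp_neg_exp (sub_pos.2 hs)
  have hcos : Real.cos π < 0 := by simp
  have l1 := (aecover_Ioi (μ := volume) (a := fun X : ℝ => X)
    (tendsto_id (α := ℝ) (x := atBot))).integral_tendsto_of_countably_generated hint
  rw [hval] at l1
  have l2 : Tendsto (fun X : ℝ => ∫ y in (-π)..π, hankelKernel s (X + y * I)) atBot (𝓝 0) := by
    have h0 : Tendsto (fun X : ℝ => rexp (rexp X + (1 - s) * X) * |π - -π|) atBot (𝓝 0) := by
      have : Tendsto (fun X : ℝ => rexp X + (1 - s) * X) atBot atBot :=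
        Real.tendsto_exp_atBot.add_atBot (tendsto_id.const_mul_atBot (sub_pos.2 hs))
      simpa using (Real.tendsto_exp_atBot.comp this).mul_const |π - -π|
    refine squeeze_zero_norm (fun X => ?_) h0
    refine intervalIntegral.norm_integral_le_of_norm_le_const fun y _ => ?_
    rw [norm_hankelKernel]
    gcongr
    exact mul_le_of_le_one_right (Real.exp_pos X).le (Real.cos_le_one y)
  have l3 := ((Complex.continuous_ofReal.tendsto _).comp l1).const_mul
    (2 * I * (Real.sin (π * s) : ℂ)) |>.add (l2.const_mul I)
  have l4 := tendsto_nhds_unique (l3.congr fun X => (hankelIntegral_hankelKernel_pi s X).symm)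
    (tendsto_const_nhds.congr fun X => hankelIntegral_hankelKernel_eq s hcos 0 X)
  rw [← l4, Complex.Gamma_ofReal, eq_div_iff (ofReal_ne_zero.2 (Real.Gamma_pos_of_pos hs0).ne')]
  have hsin : Real.sin (π * s) ≠ 0 :=
    (Real.sin_pos_of_pos_of_lt_pi (by positivity) (by nlinarith [Real.pi_pos])).ne'
  have href := Real.Gamma_mul_Gamma_one_sub s
  rw [eq_div_iff hsin] at href
  have href' : (Real.Gamma s : ℂ) * Real.Gamma (1 - s) * Real.sin (π * s) = π := by
    exact_mod_cast href
  linear_combination 2 * I * href'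

lemma hankelIntegral_hankelKernel_pi_one :
    hankelIntegral (hankelKernel 1) π 0 = 2 * π * I := by
  have hcos : Real.cos π < 0 := by simp
  have hX (X : ℝ) : hankelIntegral (hankelKernel 1) π 0
      = I * ∫ y in (-π)..π, cexp (rexp X * cexp (y * I)) := by
    rw [hankelIntegral_hankelKernel_eq 1 hcos 0 X, hankelIntegral_hankelKernel_pi]
    simp [hankelKernel, Complex.exp_add]
  have hc : Continuous fun r : ℝ => I * ∫ y in (-π)..π, cexp (r * cexp (y * I)) := by
    refine continuous_const.mul ?_
    apply intervalIntegral.continuous_parametric_intervalIntegral_of_continuous'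
    unfold Function.uncurry
    fun_prop
  have l := (hc.tendsto 0).comp Real.tendsto_exp_atBot
  have := tendsto_nhds_unique tendsto_const_nhds (l.congr fun X => (hX X).symm)
  rw [this]
  simp
  ring

lemma hankelIntegral_hankelKernel_pi_eq {s : ℝ} (hs : 0 < s) :
    hankelIntegral (hankelKernel s) π 0 = 2 * π * I / Complex.Gamma s := by
  obtain ⟨n, hn⟩ := exists_nat_ge s
  induction n generalizing s with
  | zero => exact absurd hs (by simpa using hn)
  | succ n ih =>
    rcases lt_trichotomy s 1 with h | rfl | h
    · exact hankelIntegral_hankelKernel_pi_of_lt_one hs h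
    · simpa using hankelIntegral_hankelKernel_pi_one
    · have hs1 : 0 < s - 1 := sub_pos.2 h
      have hrec := hankelIntegral_hankelKernel_add_one (s - 1) (δ := π) (by simp) 0
      rw [ih hs1 (by push_cast at hn; linarith), sub_add_cancel] at hrec
      have hne : ((s - 1 : ℝ) : ℂ) ≠ 0 := ofReal_ne_zero.2 hs1.ne'
      have hG := Complex.Gamma_add_one _ hne
      rw [← ofReal_one, ← ofReal_add, sub_add_cancel] at hG
      have hG0 : Complex.Gamma (s - 1 : ℝ) ≠ 0 := by
        rw [Complex.Gamma_ofReal]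
        exact ofReal_ne_zero.2 (Real.Gamma_pos_of_pos hs1).ne'
      rw [hG, eq_div_iff (mul_ne_zero hne hG0)]
      rw [div_eq_iff hG0] at hrec
      linear_combination -hrec

/-- Hankel's formula for the reciprocal Gamma function. -/
lemma hankelIntegral_hankelKernel {s δ : ℝ} (hs : 0 < s) (h1 : π / 2 < δ) (h2 : δ ≤ π) (X : ℝ) :
    hankelIntegral (hankelKernel s) δ X = 2 * π * I / Complex.Gamma s := by
  rw [hankelIntegral_hankelKernel_eq s
    (Real.cos_neg_of_pi_div_two_lt_of_lt h1 (by linarith [Real.pi_pos])) X 0,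
    hankelIntegral_hankelKernel_eq_pi s h1 h2, hankelIntegral_hankelKernel_pi_eq hs]

/-- Complex numbers whose arguments stay `η` apart have a difference comparable to the sum of
their norms. -/
lemma sin_half_mul_le_norm_sub {a b φ θ η : ℝ} (ha : 0 ≤ a) (hb : 0 ≤ b)
    (h : Real.cos (φ - θ) ≤ Real.cos η) :
    Real.sin (η / 2) * (a + b) ≤ ‖(a : ℂ) * cexp (φ * I) - b * cexp (θ * I)‖ := by
  refine le_of_abs_le (abs_le_of_sq_le_sq ?_ (norm_nonneg _))
  have hre : ((a : ℂ) * cexp (φ * I) - b * cexp (θ * I)).re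
      = a * Real.cos φ - b * Real.cos θ := by
    simp [Complex.exp_ofReal_mul_I_re, Complex.exp_ofReal_mul_I_im]
  have him : ((a : ℂ) * cexp (φ * I) - b * cexp (θ * I)).im
      = a * Real.sin φ - b * Real.sin θ := by
    simp [Complex.exp_ofReal_mul_I_re, Complex.exp_ofReal_mul_I_im]
  have hnorm : ‖(a : ℂ) * cexp (φ * I) - b * cexp (θ * I)‖ ^ 2
      = a ^ 2 + b ^ 2 - 2 * (a * b) * Real.cos (φ - θ) := by
    rw [Complex.sq_norm, Complex.normSq_apply, hre, him, Real.cos_sub]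
    linear_combination a ^ 2 * Real.sin_sq_add_cos_sq φ + b ^ 2 * Real.sin_sq_add_cos_sq θ
  rw [hnorm, mul_pow, Real.sin_sq_eq_half_sub, mul_div_cancel₀ η two_ne_zero]
  have h1 := mul_le_mul_of_nonneg_left h (mul_nonneg ha hb)
  have h2 := mul_nonneg (by linarith [Real.neg_one_le_cos η] : 0 ≤ 1 + Real.cos η)
    (sq_nonneg (a - b))
  linarith

lemma hankelKernel_mul_add (α β : ℝ) (k : ℕ) (w : ℂ) :
    hankelKernel (α * k + β) w = cexp (-(α * w)) ^ k * hankelKernel β w := by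
  rw [hankelKernel, hankelKernel, ← Complex.exp_nat_mul, ← Complex.exp_add]
  congr 1
  push_cast
  ring

/-- The integrand in logarithmic coordinates of the contour integral of `E_{α,β}(z)`. -/
noncomputable def mittagLefflerKernel (α β : ℝ) (z w : ℂ) : ℂ :=
  hankelKernel (β - α) w / (cexp (α * w) - z)

lemma measurable_mittagLefflerKernel (α β : ℝ) (z : ℂ) :
    Measurable (mittagLefflerKernel α β z) := by
  unfold mittagLefflerKernel
  exact (continuous_hankelKernel _).measurable.div (by fun_prop)

section Series

variable {α β X : ℝ} {z w : ℂ}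

lemma norm_mul_exp_neg_le (hα : 0 ≤ α) (hw : X ≤ w.re) :
    ‖z * cexp (-(α * w))‖ ≤ ‖z‖ * rexp (-(α * X)) := by
  rw [norm_mul, Complex.norm_exp]
  simp only [neg_re, re_ofReal_mul]
  gcongr

lemma norm_pow_mul_hankelKernel_le (hα : 0 ≤ α) (hw : X ≤ w.re) (k : ℕ) :
    ‖z ^ k * hankelKernel (α * k + β) w‖ ≤
      (‖z‖ * rexp (-(α * X))) ^ k * ‖hankelKernel β w‖ := by
  rw [hankelKernel_mul_add, ← mul_assoc, ← mul_pow, norm_mul, norm_pow]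
  gcongr
  exact norm_mul_exp_neg_le hα hw

lemma hasSum_pow_mul_hankelKernel (hα : 0 ≤ α) (hw : X ≤ w.re)
    (hz : ‖z‖ * rexp (-(α * X)) < 1) :
    HasSum (fun k : ℕ => z ^ k * hankelKernel (α * k + β) w) (mittagLefflerKernel α β z w) := by
  have hlt : ‖z * cexp (-(α * w))‖ < 1 := (norm_mul_exp_neg_le hα hw).trans_lt hz
  have h := (hasSum_geometric_of_norm_lt_one hlt).mul_right (hankelKernel β w)
  have e : (1 - z * cexp (-(α * w)))⁻¹ * hankelKernel β w = mittagLefflerKernel α β z w := by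
    have hne : 1 - z * cexp (-(α * w)) ≠ 0 := by
      intro h0
      rw [← sub_eq_zero.1 h0] at hlt
      simp at hlt
    have h1 : cexp (α * w) - z = cexp (α * w) * (1 - z * cexp (-(α * w))) := by
      rw [Complex.exp_neg]
      field_simp [Complex.exp_ne_zero]
    have h2 : hankelKernel (β - α) w = cexp (α * w) * hankelKernel β w := by
      rw [hankelKernel, hankelKernel, ← Complex.exp_add]
      congr 1
      push_cast
      ring
    rw [mittagLefflerKernel, h1, h2, mul_div_mul_left _ _ (Complex.exp_ne_zero _), div_eq_inv_mul]
  rw [← e]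
  simpa only [hankelKernel_mul_add, mul_pow, mul_assoc] using h

lemma hasSum_integral_pow_mul_hankelKernel (hα : 0 ≤ α) (hz : ‖z‖ * rexp (-(α * X)) < 1)
    {ν : Measure ℝ} {γ : ℝ → ℂ} (hγ : Measurable γ) (hre : ∀ᵐ t ∂ν, X ≤ (γ t).re)
    (hint : Integrable (fun t => hankelKernel β (γ t)) ν) :
    HasSum (fun k : ℕ => z ^ k * ∫ t, hankelKernel (α * k + β) (γ t) ∂ν)
      (∫ t, mittagLefflerKernel α β z (γ t) ∂ν) := by
  have hq : 0 ≤ ‖z‖ * rexp (-(α * X)) := by positivity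
  simp only [← integral_const_mul]
  refine hasSum_integral_of_dominated_convergence
    (fun k t => (‖z‖ * rexp (-(α * X))) ^ k * ‖hankelKernel β (γ t)‖) (fun k => ?_)
    (fun k => ?_) ?_ ?_ ?_
  · exact (((continuous_hankelKernel _).measurable.comp hγ).const_mul _).aestronglyMeasurable
  · filter_upwards [hre] with t ht
    exact norm_pow_mul_hankelKernel_le hα ht k
  · exact Eventually.of_forall fun t => (summable_geometric_of_lt_one hq hz).mul_right _
  · simp only [tsum_mul_right]
    exact hint.norm.const_mul _
  · filter_upwards [hre] with t ht
    exact hasSum_pow_mul_hankelKernel hα ht hz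

lemma mittagLeffler_eq_hankelIntegral (hα : 0 ≤ α) (hβ : 0 < β) {δ : ℝ} (h1 : π / 2 < δ)
    (h2 : δ ≤ π) (hz : ‖z‖ * rexp (-(α * X)) < 1) :
    mittagLeffler α β z = hankelIntegral (mittagLefflerKernel α β z) δ X / (2 * π * I) := by
  have hpos := Real.pi_pos
  have hcos : Real.cos δ < 0 := Real.cos_neg_of_pi_div_two_lt_of_lt h1 (by linarith)
  have ray {y : ℝ} (hy : Real.cos y < 0) := hasSum_integral_pow_mul_hankelKernel (β := β) hα hz
    (ν := volume.restrict (Ioi X)) (γ := fun x : ℝ => x + y * I) (by fun_prop)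
    (by
      filter_upwards [ae_restrict_mem measurableSet_Ioi] with x hx
      simpa using (mem_Ioi.1 hx).le) (integrableOn_hankelKernel β X hy)
  have arc := hasSum_integral_pow_mul_hankelKernel (β := β) hα hz
    (ν := volume.restrict (Ioc (-δ) δ)) (γ := fun y : ℝ => X + y * I) (by fun_prop)
    (by simp)
    (((continuous_hankelKernel β).comp (by fun_prop)).integrableOn_Ioc)
  have hsum := ((ray hcos).sub (ray (y := -δ) (by rwa [Real.cos_neg]))).add (arc.mul_left I)
  simp only [← intervalIntegral.integral_of_le (show -δ ≤ δ by linarith)] at hsum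
  have hsum' : HasSum (fun k : ℕ => z ^ k / Complex.Gamma ((α * k + β : ℝ) : ℂ))
      (hankelIntegral (mittagLefflerKernel α β z) δ X / (2 * π * I)) := by
    refine (hsum.div_const (2 * π * I)).congr_fun fun k => ?_
    have hH := hankelIntegral_hankelKernel (s := α * k + β) (by positivity) h1 h2 X
    have hne : (2 * π * I : ℂ) ≠ 0 := by simp
    rw [eq_div_iff hne]
    unfold hankelIntegral at hH
    linear_combination -z ^ k * hH
  exact hsum'.tsum_eq

end Series

lemma cos_sub_arg_le {φ θ m μ : ℝ} (hm : m ≤ μ) (hμ : μ ≤ π) (hφ : |φ| ≤ m)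
    (hθ1 : μ ≤ |θ|) (hθ2 : |θ| ≤ π) : Real.cos (φ - θ) ≤ Real.cos (μ - m) := by
  have h0 : 0 ≤ m := (abs_nonneg _).trans hφ
  have h1 : μ - m ≤ |φ - θ| := by
    have := abs_sub_abs_le_abs_sub θ φ
    rw [abs_sub_comm]
    linarith
  have h2 : |φ - θ| ≤ π + m := by
    have := abs_sub φ θ
    linarith
  rw [← Real.cos_abs (φ - θ)]
  rcases le_total |φ - θ| π with h | h
  · exact Real.cos_le_cos_of_nonneg_of_le_pi (by linarith) h h1
  · rw [← Real.cos_two_pi_sub]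
    exact Real.cos_le_cos_of_nonneg_of_le_pi (by linarith) (by linarith) (by linarith)

lemma sin_half_mul_le_norm_exp_sub {α δ μ : ℝ} {z : ℂ} (hα : 0 ≤ α) (hδ : α * δ ≤ μ)
    (hμ : μ ≤ π) (hz : μ ≤ |z.arg|) {w : ℂ} (hw : |w.im| ≤ δ) :
    Real.sin ((μ - α * δ) / 2) * (rexp (α * w.re) + ‖z‖) ≤ ‖cexp (α * w) - z‖ := by
  have h := cos_sub_arg_le hδ hμ (φ := α * w.im)
    (by rw [abs_mul, abs_of_nonneg hα]; gcongr) hz (Complex.abs_arg_le_pi z)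
  have h' := sin_half_mul_le_norm_sub (Real.exp_pos (α * w.re)).le (norm_nonneg z) h
  rw [Complex.norm_mul_exp_arg_mul_I, ofReal_exp, ← Complex.exp_add] at h'
  convert h' using 4
  conv_lhs => rw [← Complex.re_add_im w]
  push_cast
  ring

/-- For `1 < α < 2`, `β > 0` and `πα/2 < μ < π`, there is `C > 0` such that
`|E_{α,β}(z)| ≤ C / (1 + |z|)` whenever `μ ≤ |arg z| ≤ π`. -/
theorem mittagLeffler_decay (α β μ : ℝ) (hα1 : 1 < α) (hα2 : α < 2) (hβ : 0 < β)
    (hμ1 : Real.pi * α / 2 < μ) (hμ2 : μ < Real.pi) :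
    ∃ C : ℝ, 0 < C ∧ ∀ z : ℂ, μ ≤ |z.arg| → |z.arg| ≤ Real.pi →
      ‖mittagLeffler α β z‖ ≤ C / (1 + ‖z‖) := by
  have hpos := Real.pi_pos
  obtain ⟨δ, h1, hδμ⟩ : ∃ δ, π / 2 < δ ∧ δ < μ / α := exists_between (by
    rw [lt_div_iff₀ (by linarith)]
    linarith)
  rw [lt_div_iff₀' (by linarith)] at hδμ
  have h2 : δ ≤ π := by nlinarith
  have hcos : Real.cos δ < 0 := Real.cos_neg_of_pi_div_two_lt_of_lt h1 (by linarith)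
  have hcos' : Real.cos (-δ) < 0 := by rwa [Real.cos_neg]
  have hδ0 : 0 < δ := by linarith
  set c : ℝ := Real.sin ((μ - α * δ) / 2) with hc_def
  have hc : 0 < c := Real.sin_pos_of_pos_of_lt_pi (by linarith) (by nlinarith)
  set K := hankelKernel (β - α)
  set M : ℝ := (∫ x : ℝ in Ioi 0, ‖K (x + δ * I)‖) + (∫ x : ℝ in Ioi 0, ‖K (x + (-δ : ℝ) * I)‖)
    + ∫ y in (-δ)..δ, ‖K ((0 : ℝ) + y * I)‖ with hM
  have hM0 : 0 ≤ M := by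
    have : 0 ≤ ∫ y in (-δ)..δ, ‖K ((0 : ℝ) + y * I)‖ :=
      intervalIntegral.integral_nonneg (by linarith) fun _ _ => norm_nonneg _
    positivity
  refine ⟨(M + 1) / (2 * π * c), by positivity, fun z hz _ => ?_⟩
  have hz0 := norm_nonneg z
  have hlow {w : ℂ} (hw : |w.im| ≤ δ) : c * (rexp (α * w.re) + ‖z‖) ≤ ‖cexp (α * w) - z‖ :=
    sin_half_mul_le_norm_exp_sub (by linarith) hδμ.le hμ2.le hz hw
  have hne {w : ℂ} (hw : |w.im| ≤ δ) : cexp (α * w) - z ≠ 0 :=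
    norm_pos_iff.1 (lt_of_lt_of_le (by positivity) (hlow hw))
  have hbound {w : ℂ} (hre : 0 ≤ w.re) (hw : |w.im| ≤ δ) :
      ‖mittagLefflerKernel α β z w‖ ≤ (c * (1 + ‖z‖))⁻¹ * ‖K w‖ := by
    rw [mittagLefflerKernel, norm_div, div_eq_inv_mul]
    have : 1 ≤ rexp (α * w.re) := Real.one_le_exp (by positivity)
    gcongr
    exact le_trans (by gcongr) (hlow hw)
  have hbray {y : ℝ} (hy : |y| ≤ δ) : ∀ᵐ x : ℝ ∂volume.restrict (Ioi 0),
      ‖mittagLefflerKernel α β z (x + y * I)‖ ≤ (c * (1 + ‖z‖))⁻¹ * ‖K (x + y * I)‖ := by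
    filter_upwards [ae_restrict_mem measurableSet_Ioi] with x hx
    exact hbound (by simpa using (mem_Ioi.1 hx).le) (by simpa using hy)
  have hiray {y : ℝ} (hy : Real.cos y < 0) :=
    (integrableOn_hankelKernel (β - α) 0 hy).norm.const_mul (c * (1 + ‖z‖))⁻¹
  have hGray {y : ℝ} (hy : |y| ≤ δ) (hy' : Real.cos y < 0) :
      IntegrableOn (fun x : ℝ => mittagLefflerKernel α β z (x + y * I)) (Ioi 0) :=
    (hiray hy').mono' ((measurable_mittagLefflerKernel α β z).comp
      (by fun_prop)).aestronglyMeasurable (hbray hy)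
  have hδδ : |δ| ≤ δ := (abs_of_pos hδ0).le
  have hδδ' : |-δ| ≤ δ := by rwa [abs_neg]
  obtain ⟨X, hX0, hX⟩ : ∃ X : ℝ, 0 ≤ X ∧ ‖z‖ * rexp (-(α * X)) < 1 := by
    refine ⟨‖z‖, hz0, ?_⟩
    rw [Real.exp_neg, ← div_eq_mul_inv, div_lt_one (Real.exp_pos _)]
    nlinarith [Real.add_one_le_exp (α * ‖z‖)]
  have hshift : hankelIntegral (mittagLefflerKernel α β z) δ 0
      = hankelIntegral (mittagLefflerKernel α β z) δ X := by
    refine hankelIntegral_eq_of_differentiableOn hX0 (fun w hw => ?_) (hGray hδδ hcos)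
      (hGray hδδ' hcos')
    have him := (mem_reProdIm.1 hw).2
    rw [uIcc_of_le (by linarith)] at him
    refine DifferentiableAt.differentiableWithinAt ?_
    unfold mittagLefflerKernel
    exact (differentiable_hankelKernel _ w).div (by fun_prop) (hne (abs_le.2 him))
  have hray {y : ℝ} (hy : |y| ≤ δ) (hy' : Real.cos y < 0) :
      ‖∫ x : ℝ in Ioi 0, mittagLefflerKernel α β z (x + y * I)‖
        ≤ (c * (1 + ‖z‖))⁻¹ * ∫ x : ℝ in Ioi 0, ‖K (x + y * I)‖ := by
    rw [← integral_const_mul]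
    exact norm_integral_le_of_norm_le (hiray hy') (hbray hy)
  have harc : ‖I * ∫ y in (-δ)..δ, mittagLefflerKernel α β z ((0 : ℝ) + y * I)‖
      ≤ (c * (1 + ‖z‖))⁻¹ * ∫ y in (-δ)..δ, ‖K ((0 : ℝ) + y * I)‖ := by
    rw [norm_mul, norm_I, one_mul, ← intervalIntegral.integral_const_mul]
    refine intervalIntegral.norm_integral_le_of_norm_le (by linarith)
      (Eventually.of_forall fun y hy => hbound (by simp) ?_) ?_
    · simpa using abs_le.2 ⟨hy.1.le, hy.2⟩
    · exact (continuous_const.mul ((continuous_hankelKernel _).comp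
        (by fun_prop)).norm).intervalIntegrable _ _
  have hJ : ‖hankelIntegral (mittagLefflerKernel α β z) δ 0‖ ≤ (c * (1 + ‖z‖))⁻¹ * M := by
    unfold hankelIntegral
    refine (norm_add_le _ _).trans ?_
    rw [hM, mul_add, mul_add]
    gcongr
    exact (norm_sub_le _ _).trans (add_le_add (hray hδδ hcos) (hray hδδ' hcos'))
  rw [mittagLeffler_eq_hankelIntegral (by linarith) hβ h1 h2 hX, ← hshift, norm_div]
  have h2pi : ‖(2 * π * I : ℂ)‖ = 2 * π := by simp [abs_of_pos hpos]
  rw [h2pi]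
  calc _ ≤ (c * (1 + ‖z‖))⁻¹ * (M + 1) / (2 * π) := by
        gcongr
        exact hJ.trans (by gcongr; linarith)
    _ = _ := by field_simp
end

section
/- Let 1 < α < 2 and θ ∈ (1/α, 1). Let (λ_n) be a sequence of positive reals, let (a_n) satisfy Σ_n a_n² < ∞ and let (c_n) satisfy Σ_n λ_n^{−2/α} c_n² < ∞. Then lim_{t→0⁺} Σ_{n=1}^∞ λ_n^{−2θ} | −λ_n a_n t^{α−1} E_{α,α}(−λ_n t^α) + c_n (E_{α,1}(−λ_n t^α) − 1) |² = 0. (This is the spectral-coefficient form of the statement that ∂_t u(t,·) → u₁ in D(A^{−θ}) as t → 0 for u₀ ∈ L²(Ω) and u₁ ∈ D(A^{−1/α}).) -/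
open Complex Real Filter Topology

open MeasureTheory

theorem integral_rpow_mul_sub_rpow {p q t : ℝ} (hp : 0 < p) (hq : 0 < q) (ht : 0 < t) :
    ∫ s in (0 : ℝ)..t, s ^ (p - 1) * (t - s) ^ (q - 1) =
      Real.Gamma p * Real.Gamma q / Real.Gamma (p + q) * t ^ (p + q - 1) := by
  have h1 := Complex.betaIntegral_scaled (p : ℂ) (q : ℂ) ht
  have h2 := Complex.Gamma_mul_Gamma_eq_betaIntegral (s := (p : ℂ)) (t := (q : ℂ))
    (by simpa using hp) (by simpa using hq)
  have hG : (Real.Gamma (p + q) : ℂ) ≠ 0 := by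
    exact_mod_cast (Real.Gamma_pos_of_pos (add_pos hp hq)).ne'
  rw [← Complex.ofReal_add, Complex.Gamma_ofReal, Complex.Gamma_ofReal, Complex.Gamma_ofReal,
    mul_comm (Real.Gamma (p + q) : ℂ), ← div_eq_iff hG] at h2
  rw [← h2] at h1
  have h3 : ∫ x in (0 : ℝ)..t, (x : ℂ) ^ ((p : ℂ) - 1) * ((t : ℂ) - x) ^ ((q : ℂ) - 1) =
      ((∫ s in (0 : ℝ)..t, s ^ (p - 1) * (t - s) ^ (q - 1) : ℝ) : ℂ) := by
    rw [← intervalIntegral.integral_ofReal]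
    refine intervalIntegral.integral_congr fun s hs => ?_
    rw [Set.uIcc_of_le ht.le] at hs
    simp only [Complex.ofReal_mul]
    rw [Complex.ofReal_cpow hs.1, Complex.ofReal_cpow (sub_nonneg.2 hs.2)]
    push_cast
    rfl
  rw [h3] at h1
  have h4 : (t : ℂ) ^ ((p : ℂ) + q - 1) = ((t ^ (p + q - 1) : ℝ) : ℂ) := by
    rw [Complex.ofReal_cpow ht.le]; push_cast; rfl
  rw [h4] at h1
  have h5 : ((∫ s in (0 : ℝ)..t, s ^ (p - 1) * (t - s) ^ (q - 1) : ℝ) : ℂ) =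
      ((Real.Gamma p * Real.Gamma q / Real.Gamma (p + q) * t ^ (p + q - 1) : ℝ) : ℂ) := by
    rw [h1]; push_cast; ring
  exact_mod_cast h5

theorem intervalIntegrable_rpow_mul_sub_rpow {p q t : ℝ} (hp : 0 < p) (hq : 0 < q) (ht : 0 < t) :
    IntervalIntegrable (fun s => s ^ (p - 1) * (t - s) ^ (q - 1)) volume 0 t := by
  by_contra h
  have h1 := integral_rpow_mul_sub_rpow hp hq ht
  rw [intervalIntegral.integral_undef h] at h1
  have := Real.Gamma_pos_of_pos hp
  have := Real.Gamma_pos_of_pos hq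
  have := Real.Gamma_pos_of_pos (add_pos hp hq)
  have : 0 < Real.Gamma p * Real.Gamma q / Real.Gamma (p + q) * t ^ (p + q - 1) := by positivity
  exact this.ne h1

/-- The real function `x ↦ E_{α,β}(-x)`. -/
noncomputable def mittagLefflerNeg (α β x : ℝ) : ℝ :=
  ∑' k : ℕ, (-x) ^ k / Real.Gamma (α * k + β)

theorem mittagLeffler_ofReal_neg (α β x : ℝ) :
    mittagLeffler α β ((-x : ℝ) : ℂ) = (mittagLefflerNeg α β x : ℂ) := by
  rw [mittagLeffler, mittagLefflerNeg, Complex.ofReal_tsum]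
  refine tsum_congr fun k => ?_
  rw [Complex.Gamma_ofReal]
  push_cast
  rfl

theorem factorial_le_Gamma {α β : ℝ} (hα : 1 ≤ α) (hβ : 1 ≤ β) {k : ℕ} (hk : k ≠ 0) :
    (k.factorial : ℝ) ≤ Real.Gamma (α * k + β) := by
  have hk' : (1 : ℝ) ≤ k := by exact_mod_cast Nat.one_le_iff_ne_zero.2 hk
  have h : (k : ℝ) + 1 ≤ α * k + β := by nlinarith
  rw [← Real.Gamma_nat_eq_factorial]
  exact Real.Gamma_strictMonoOn_Ici.monotoneOn (Set.mem_Ici.2 (by linarith))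
    (Set.mem_Ici.2 (by linarith)) h

theorem norm_mittagLefflerNeg_term_le {α β : ℝ} (hα : 1 ≤ α) (hβ : 1 ≤ β) {x M : ℝ}
    (hx : |x| ≤ M) (k : ℕ) :
    ‖(-x) ^ k / Real.Gamma (α * k + β)‖ ≤ (1 + 1 / Real.Gamma β) * (M ^ k / k.factorial) := by
  have hG : 0 < Real.Gamma β := Real.Gamma_pos_of_pos (by linarith)
  have hGk : 0 < Real.Gamma (α * k + β) := Real.Gamma_pos_of_pos (by positivity)
  have hM : 0 ≤ M := (abs_nonneg x).trans hx
  rw [norm_div, norm_pow, norm_neg, Real.norm_eq_abs, Real.norm_eq_abs, abs_of_pos hGk]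
  rcases eq_or_ne k 0 with rfl | hk
  · simp
  · have hf := factorial_le_Gamma hα hβ hk
    have h0 : (0 : ℝ) < k.factorial := by positivity
    calc |x| ^ k / Real.Gamma (α * k + β) ≤ M ^ k / k.factorial := by gcongr
      _ ≤ _ := le_mul_of_one_le_left (by positivity) (by simp [hG.le])

theorem summable_mittagLefflerNeg {α β : ℝ} (hα : 1 ≤ α) (hβ : 1 ≤ β) (x : ℝ) :
    Summable fun k : ℕ => (-x) ^ k / Real.Gamma (α * k + β) :=
  Summable.of_norm_bounded ((Real.summable_pow_div_factorial |x|).mul_left _)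
    (norm_mittagLefflerNeg_term_le hα hβ le_rfl)

theorem continuous_mittagLefflerNeg {α β : ℝ} (hα : 1 ≤ α) (hβ : 1 ≤ β) :
    Continuous (mittagLefflerNeg α β) := by
  rw [continuous_iff_continuousAt]
  intro x
  have h : ContinuousOn (mittagLefflerNeg α β) (Set.Icc (-(|x| + 1)) (|x| + 1)) :=
    continuousOn_tsum (fun k => by fun_prop)
      ((Real.summable_pow_div_factorial (|x| + 1)).mul_left _)
      fun k y hy => norm_mittagLefflerNeg_term_le hα hβ (abs_le.2 hy) k
  exact h.continuousAt (Icc_mem_nhds (by linarith [neg_abs_le x]) (by linarith [le_abs_self x]))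

theorem mittagLefflerNeg_one_eq {α : ℝ} (hα : 1 ≤ α) (x : ℝ) :
    mittagLefflerNeg α 1 x = 1 - x * mittagLefflerNeg α (α + 1) x := by
  rw [mittagLefflerNeg, (summable_mittagLefflerNeg hα le_rfl x).tsum_eq_zero_add,
    mittagLefflerNeg, ← tsum_mul_left, sub_eq_add_neg, ← tsum_neg]
  congr 1
  · simp
  · refine tsum_congr fun k => ?_
    rw [show α * ((k + 1 : ℕ) : ℝ) + 1 = α * k + (α + 1) by push_cast; ring]
    ring

/-- The Riemann–Liouville integral of order `γ` maps `s ^ (β - 1) E_{α,β}(-s ^ α)` to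
`t ^ (β + γ - 1) E_{α,β+γ}(-t ^ α)`. -/
theorem integral_sub_rpow_mul_mittagLefflerNeg {α β γ t : ℝ} (hα : 1 ≤ α) (hβ : 1 ≤ β)
    (hγ : 0 < γ) (ht : 0 < t) :
    ∫ s in (0 : ℝ)..t, (t - s) ^ (γ - 1) * (s ^ (β - 1) * mittagLefflerNeg α β (s ^ α)) =
      Real.Gamma γ * (t ^ (β + γ - 1) * mittagLefflerNeg α (β + γ) (t ^ α)) := by
  have hpos : ∀ k : ℕ, 0 < α * k + β := fun k => by positivity
  have hpow : ∀ s : ℝ, 0 < s → ∀ (k : ℕ) (δ : ℝ),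
      s ^ (α * k + δ - 1) = s ^ (δ - 1) * (s ^ α) ^ k := fun s hs k δ => by
    rw [← Real.rpow_natCast, ← Real.rpow_mul hs.le, ← Real.rpow_add hs]; congr 1; ring
  let F : ℕ → ℝ → ℝ := fun k s =>
    (-1) ^ k / Real.Gamma (α * k + β) * (s ^ (α * k + β - 1) * (t - s) ^ (γ - 1))
  have hint : ∀ k, Integrable (F k) (volume.restrict (Set.Ioc 0 t)) := fun k =>
    ((intervalIntegrable_iff_integrableOn_Ioc_of_le ht.le).1
      (intervalIntegrable_rpow_mul_sub_rpow (hpos k) hγ ht)).const_mul _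
  have hbeta : ∀ k : ℕ, ∫ s in Set.Ioc 0 t, s ^ (α * k + β - 1) * (t - s) ^ (γ - 1) =
      Real.Gamma (α * k + β) * Real.Gamma γ / Real.Gamma (α * k + β + γ) *
        t ^ (α * k + β + γ - 1) := fun k => by
    rw [← intervalIntegral.integral_of_le ht.le]
    exact integral_rpow_mul_sub_rpow (hpos k) hγ ht
  have hnorm : ∀ k, ∫ s in Set.Ioc 0 t, ‖F k s‖ =
      Real.Gamma γ * t ^ (β + γ - 1) * ‖(-(t ^ α)) ^ k / Real.Gamma (α * k + (β + γ))‖ := by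
    intro k
    have h1 : ∀ s ∈ Set.Ioc 0 t, ‖F k s‖ =
        1 / Real.Gamma (α * k + β) * (s ^ (α * k + β - 1) * (t - s) ^ (γ - 1)) := by
      intro s hs
      have := Real.Gamma_pos_of_pos (hpos k)
      have := Real.rpow_nonneg hs.1.le (α * k + β - 1)
      have := Real.rpow_nonneg (sub_nonneg.2 hs.2) (γ - 1)
      rw [norm_mul, norm_div, norm_pow, norm_neg, norm_one, one_pow,
        Real.norm_of_nonneg (by positivity),
        Real.norm_of_nonneg (by positivity)]
    rw [setIntegral_congr_fun measurableSet_Ioc h1, integral_const_mul, hbeta, add_assoc,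
      hpow t ht]
    have := Real.Gamma_pos_of_pos (hpos k)
    have h2 := Real.Gamma_pos_of_pos (show 0 < α * k + (β + γ) by positivity)
    rw [norm_div, norm_pow, norm_neg, Real.norm_of_nonneg (by positivity),
        Real.norm_of_nonneg h2.le]
    field_simp
  have hsum : Summable fun k => ∫ s in Set.Ioc 0 t, ‖F k s‖ := by
    simp_rw [hnorm]
    exact ((summable_mittagLefflerNeg hα (by linarith) _).norm).mul_left _
  have key := (hasSum_integral_of_summable_integral_norm hint hsum).tsum_eq
  rw [intervalIntegral.integral_of_le ht.le]
  have hL : ∀ s ∈ Set.Ioc 0 t, (t - s) ^ (γ - 1) * (s ^ (β - 1) * mittagLefflerNeg α β (s ^ α)) =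
      ∑' k, F k s := by
    intro s hs
    rw [mittagLefflerNeg, ← tsum_mul_left, ← tsum_mul_left]
    refine tsum_congr fun k => ?_
    simp only [F]
    rw [hpow s hs.1, neg_pow (s ^ α)]
    ring
  rw [setIntegral_congr_fun measurableSet_Ioc hL, ← key, mittagLefflerNeg, ← tsum_mul_left,
    ← tsum_mul_left]
  refine tsum_congr fun k => ?_
  simp only [F]
  rw [integral_const_mul, hbeta, add_assoc, hpow t ht, neg_pow (t ^ α)]
  have := Real.Gamma_pos_of_pos (hpos k)
  field_simp

theorem integral_mul_exp_convolution_nonneg {u : ℝ → ℝ} (hu : Continuous u) {r T : ℝ}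
    (hr : 0 ≤ r) (hT : 0 ≤ T) :
    0 ≤ ∫ t in (0 : ℝ)..T, u t * ∫ s in (0 : ℝ)..t, Real.exp (-(r * (t - s))) * u s := by
  let w : ℝ → ℝ := fun t => Real.exp (-(r * t)) * ∫ s in (0 : ℝ)..t, Real.exp (r * s) * u s
  have hw : ∀ t, ∫ s in (0 : ℝ)..t, Real.exp (-(r * (t - s))) * u s = w t := fun t => by
    simp only [w]
    rw [← intervalIntegral.integral_const_mul]
    refine intervalIntegral.integral_congr fun s _ => ?_
    rw [← mul_assoc, ← Real.exp_add]
    congr 2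
    ring
  have hderiv : ∀ t, HasDerivAt w (u t - r * w t) t := fun t => by
    have h1 : HasDerivAt (fun t => Real.exp (-(r * t))) (Real.exp (-(r * t)) * (-(r * 1))) t :=
      (((hasDerivAt_id t).const_mul r).neg).exp
    have h2 : HasDerivAt (fun t => ∫ s in (0 : ℝ)..t, Real.exp (r * s) * u s)
        (Real.exp (r * t) * u t) t :=
      (show Continuous fun s => Real.exp (r * s) * u s by fun_prop).integral_hasStrictDerivAt 0 t
        |>.hasDerivAt
    convert! h1.mul h2 using 1
    have h3 : Real.exp (-(r * t)) * Real.exp (r * t) = 1 := by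
      rw [← Real.exp_add]; simp
    simp only [w]
    linear_combination (-(u t)) * h3
  have hwc : Continuous w := continuous_iff_continuousAt.2 fun t => (hderiv t).continuousAt
  have hsq : ∀ t, HasDerivAt (fun t => w t ^ 2 / 2) (w t * (u t - r * w t)) t := fun t => by
    convert! ((hderiv t).pow 2).div_const 2 using 1
    push_cast
    ring
  have hint : ∫ t in (0 : ℝ)..T, w t * (u t - r * w t) = w T ^ 2 / 2 - w 0 ^ 2 / 2 :=
    intervalIntegral.integral_eq_sub_of_hasDerivAt (fun t _ => hsq t)
      (Continuous.intervalIntegrable (by fun_prop) _ _)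
  have hw0 : w 0 = 0 := by simp [w]
  simp_rw [hw]
  calc (0 : ℝ) ≤ w T ^ 2 / 2 - w 0 ^ 2 / 2 := by rw [hw0]; nlinarith [sq_nonneg (w T)]
    _ = _ := hint.symm
    _ ≤ _ := by
      refine intervalIntegral.integral_mono_on hT (Continuous.intervalIntegrable (by fun_prop) _ _)
        (Continuous.intervalIntegrable (by fun_prop) _ _) fun t _ => ?_
      nlinarith [mul_nonneg hr (sq_nonneg (w t))]

theorem integral_rpow_sub_one {β t : ℝ} (hβ : 0 < β) :
    ∫ s in (0 : ℝ)..t, (t - s) ^ (β - 1) = t ^ β / β := by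
  rw [intervalIntegral.integral_comp_sub_left (fun x => x ^ (β - 1)) t, sub_self, sub_zero,
    integral_rpow (Or.inl (by linarith)), sub_add_cancel, Real.zero_rpow hβ.ne', sub_zero]

theorem intervalIntegrable_sub_rpow {β : ℝ} (hβ : 0 < β) (a b c : ℝ) :
    IntervalIntegrable (fun s : ℝ => (c - s) ^ (β - 1)) volume a b :=
  by simpa using (intervalIntegral.intervalIntegrable_rpow' (a := c - a) (b := c - b) (r := β - 1)
    (by linarith)).comp_sub_left c

/-- The kernel `s ^ (β - 1)` with `0 < β < 1` is of positive type. -/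
theorem integral_mul_rpow_convolution_nonneg {u : ℝ → ℝ} (hu : Continuous u) {β T : ℝ}
    (hβ0 : 0 < β) (hβ1 : β < 1) (hT : 0 ≤ T) :
    0 ≤ ∫ t in (0 : ℝ)..T, u t * ∫ s in (0 : ℝ)..t, (t - s) ^ (β - 1) * u s := by
  let μ : Measure ℝ := volume.restrict (Set.Ioc 0 T)
  let ν : Measure ℝ := volume.restrict (Set.Ioi 0)
  let S : Set (ℝ × ℝ) := {p | p.2 < p.1}
  have hS : MeasurableSet S := measurableSet_lt measurable_snd measurable_fst
  let g : (ℝ × ℝ) → ℝ → ℝ := fun p r =>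
    S.indicator (fun p => Real.exp (-(r * (p.1 - p.2))) * r ^ (-β)) p
  let f : (ℝ × ℝ) → ℝ → ℝ := fun p r => u p.1 * u p.2 * g p r
  let k : (ℝ × ℝ) → ℝ := S.indicator fun p => Real.Gamma (1 - β) * (p.1 - p.2) ^ (β - 1)
  have hgm : Measurable (Function.uncurry g) := by
    have : Function.uncurry g = (Prod.fst ⁻¹' S : Set ((ℝ × ℝ) × ℝ)).indicator
        fun q => Real.exp (-(q.2 * (q.1.1 - q.1.2))) * q.2 ^ (-β) := by
      ext ⟨p, r⟩
      simp only [Function.uncurry, g, Set.indicator, Set.mem_preimage]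
    rw [this]
    exact Measurable.indicator (by fun_prop) (measurable_fst hS)
  have hg0 : ∀ p, ∀ r ∈ Set.Ioi (0 : ℝ), 0 ≤ g p r := fun p r hr =>
    Set.indicator_nonneg (fun p _ => mul_nonneg (Real.exp_pos _).le (Real.rpow_nonneg (le_of_lt hr) _)) _
  have hgint : ∀ p, Integrable (g p) ν ∧ ∫ r, g p r ∂ν = k p := fun p => by
    by_cases hp : p ∈ S
    · have hp' : 0 < p.1 - p.2 := sub_pos.2 hp
      have e : g p = fun r => r ^ (1 - β - 1) * Real.exp (-((p.1 - p.2) * r)) := by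
        ext r
        simp only [g, Set.indicator_of_mem hp]
        rw [mul_comm, mul_comm r]
        congr 2
        ring
      rw [e]
      have hI := Real.integral_rpow_mul_exp_neg_mul_Ioi (a := 1 - β) (by linarith) hp'
      have hk : k p = (1 / (p.1 - p.2)) ^ (1 - β) * Real.Gamma (1 - β) := by
        simp only [k, Set.indicator_of_mem hp]
        rw [one_div, Real.inv_rpow hp'.le, ← Real.rpow_neg hp'.le, mul_comm]
        congr 2
        ring
      refine ⟨?_, by rw [hk]; exact hI⟩
      by_contra hni
      have := integral_undef hni
      simp only [ν] at this
      rw [hI] at this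
      have h2 := Real.Gamma_pos_of_pos (show 0 < 1 - β by linarith)
      have : 0 < (1 / (p.1 - p.2)) ^ (1 - β) * Real.Gamma (1 - β) := by positivity
      linarith
    · have e : g p = fun _ => 0 := by ext r; simp only [g, Set.indicator_of_notMem hp]
      rw [e]
      simp [k, Set.indicator_of_notMem hp]
  have hk_apply : ∀ t ∈ Set.Ioc 0 T, ∀ h : ℝ → ℝ, ∫ s, k (t, s) * h s ∂μ =
      Real.Gamma (1 - β) * ∫ s in (0 : ℝ)..t, (t - s) ^ (β - 1) * h s := fun t ht h => by
    have e : ∀ s, k (t, s) * h s = (Set.Iio t).indicator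
        (fun s => Real.Gamma (1 - β) * ((t - s) ^ (β - 1) * h s)) s := fun s => by
      by_cases hs : s < t
      · rw [Set.indicator_of_mem (by exact hs)]
        simp only [k]
        rw [Set.indicator_of_mem (by exact hs), mul_assoc]
      · rw [Set.indicator_of_notMem (by exact hs)]
        simp only [k]
        rw [Set.indicator_of_notMem (by exact hs), zero_mul]
    simp_rw [e]
    rw [integral_indicator measurableSet_Iio, Measure.restrict_restrict measurableSet_Iio,
      integral_const_mul, intervalIntegral.integral_of_le ht.1.le, integral_Ioc_eq_integral_Ioo]
    congr 3
    ext s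
    simp only [Set.mem_inter_iff, Set.mem_Iio, Set.mem_Ioc, Set.mem_Ioo]
    exact ⟨fun h => ⟨h.2.1, h.1⟩, fun h => ⟨h.2, h.1, h.2.le.trans ht.2⟩⟩
  have hkm : Measurable k := Measurable.indicator (by fun_prop) hS
  have hG := Real.Gamma_pos_of_pos (show 0 < 1 - β by linarith)
  have hk0 : ∀ p, 0 ≤ k p := Set.indicator_nonneg fun p hp =>
    mul_nonneg hG.le (Real.rpow_nonneg (sub_nonneg.2 (le_of_lt hp)) _)
  have hkint : Integrable k (μ.prod μ) := by
    rw [integrable_prod_iff hkm.aestronglyMeasurable]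
    constructor
    · filter_upwards [ae_restrict_mem measurableSet_Ioc] with t ht
      have e : (fun s => k (t, s)) = (Set.Iio t).indicator
          (fun s => Real.Gamma (1 - β) * (t - s) ^ (β - 1)) := rfl
      rw [e, integrable_indicator_iff measurableSet_Iio]
      refine Integrable.mono_measure
        (((intervalIntegrable_iff_integrableOn_Ioc_of_le ht.1.le).1
          (intervalIntegrable_sub_rpow hβ0 0 t t)).const_mul _) ?_
      simp only [μ]
      rw [Measure.restrict_restrict measurableSet_Iio]
      exact Measure.restrict_mono (fun s hs => ⟨hs.2.1, le_of_lt hs.1⟩ : _ ⊆ Set.Ioc 0 t) le_rfl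
    · have hb : Integrable (fun t : ℝ => Real.Gamma (1 - β) * (t ^ β / β)) μ :=
        (((Real.continuous_rpow_const hβ0.le).div_const β).const_mul _ |>.integrableOn_Ioc)
      refine hb.congr ?_
      filter_upwards [ae_restrict_mem measurableSet_Ioc] with t ht
      have := hk_apply t ht fun _ => 1
      simp only [mul_one, integral_rpow_sub_one hβ0] at this
      rw [← this]
      exact integral_congr_ae (ae_of_all _ fun s => (Real.norm_of_nonneg (hk0 _)).symm)
  obtain ⟨M, hM⟩ := (isCompact_Icc (a := (0 : ℝ)) (b := T)).exists_bound_of_continuousOn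
    hu.continuousOn
  have hmem : ∀ᵐ p ∂(μ.prod μ), p ∈ Set.Ioc 0 T ×ˢ Set.Ioc 0 T := by
    simp only [μ]
    rw [Measure.prod_restrict]
    exact ae_restrict_mem (measurableSet_Ioc.prod measurableSet_Ioc)
  have hfm : Measurable (Function.uncurry f) := by
    have : Measurable u := hu.measurable
    exact ((this.comp (measurable_fst.comp measurable_fst)).mul
      (this.comp (measurable_snd.comp measurable_fst))).mul hgm
  have huk : Integrable (fun p => u p.1 * u p.2 * k p) (μ.prod μ) := by
    refine hkint.bdd_mul (c := M * M) ?_ ?_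
    · exact (show Continuous fun p : ℝ × ℝ => u p.1 * u p.2 by fun_prop).aestronglyMeasurable
    · filter_upwards [hmem] with p hp
      rw [norm_mul]
      have h1 := hM p.1 ⟨hp.1.1.le, hp.1.2⟩
      have h2 := hM p.2 ⟨hp.2.1.le, hp.2.2⟩
      exact mul_le_mul h1 h2 (norm_nonneg _) ((norm_nonneg _).trans h1)
  have hfint : Integrable (Function.uncurry f) ((μ.prod μ).prod ν) := by
    rw [integrable_prod_iff hfm.aestronglyMeasurable]
    refine ⟨ae_of_all _ fun p => (hgint p).1.const_mul (u p.1 * u p.2), ?_⟩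
    refine huk.norm.congr (ae_of_all _ fun p => ?_)
    have : ∀ r ∈ Set.Ioi (0 : ℝ), ‖Function.uncurry f (p, r)‖ = ‖u p.1 * u p.2‖ * g p r :=
      fun r hr => by
        simp only [Function.uncurry, f]
        rw [norm_mul, Real.norm_of_nonneg (hg0 p r hr)]
    simp only [ν]
    rw [setIntegral_congr_fun measurableSet_Ioi this, integral_const_mul, (hgint p).2, norm_mul,
      Real.norm_of_nonneg (hk0 p)]
  have hswap := integral_integral_swap hfint
  have hleft : ∫ p, ∫ r, f p r ∂ν ∂(μ.prod μ) = Real.Gamma (1 - β) *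
      ∫ t in (0 : ℝ)..T, u t * ∫ s in (0 : ℝ)..t, (t - s) ^ (β - 1) * u s := by
    simp only [f]
    simp_rw [integral_const_mul, (hgint _).2]
    rw [integral_prod _ huk, intervalIntegral.integral_of_le hT, ← integral_const_mul]
    refine setIntegral_congr_fun measurableSet_Ioc fun t ht => ?_
    simp only
    rw [mul_left_comm, ← hk_apply t ht, ← integral_const_mul]
    congr 1 with s
    ring
  have hright : 0 ≤ ∫ r, ∫ p, f p r ∂(μ.prod μ) ∂ν := by
    refine setIntegral_nonneg measurableSet_Ioi fun r hr => ?_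
    by_cases hI : Integrable (fun p => f p r) (μ.prod μ)
    · rw [integral_prod _ hI]
      have := mul_nonneg (Real.rpow_nonneg (le_of_lt hr) (-β))
        (integral_mul_exp_convolution_nonneg hu (le_of_lt hr) hT)
      rw [intervalIntegral.integral_of_le hT, ← integral_const_mul] at this
      refine this.trans_eq (setIntegral_congr_fun measurableSet_Ioc fun t ht => ?_)
      have e : ∀ s, f (t, s) r = (Set.Iio t).indicator
          (fun s => r ^ (-β) * (u t * (Real.exp (-(r * (t - s))) * u s))) s := fun s => by
        by_cases hs : s < t
        · rw [Set.indicator_of_mem (by exact hs)]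
          simp only [f, g]
          rw [Set.indicator_of_mem (by exact hs)]
          ring
        · rw [Set.indicator_of_notMem (by exact hs)]
          simp only [f, g]
          rw [Set.indicator_of_notMem (by exact hs), mul_zero]
      simp_rw [e]
      rw [integral_indicator measurableSet_Iio, Measure.restrict_restrict measurableSet_Iio,
        integral_const_mul, integral_const_mul, intervalIntegral.integral_of_le ht.1.le,
        integral_Ioc_eq_integral_Ioo]
      congr 4
      ext s
      simp only [Set.mem_inter_iff, Set.mem_Iio, Set.mem_Ioc, Set.mem_Ioo]
      exact ⟨fun h => ⟨h.2, h.1, h.2.le.trans ht.2⟩, fun h => ⟨h.2.1, h.1⟩⟩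
    · rw [integral_undef hI]
  rw [← hswap, hleft] at hright
  exact (mul_nonneg_iff_of_pos_left hG).1 hright

theorem integral_rpow_mul_mittagLefflerNeg {α t : ℝ} (hα : 1 < α) (ht : 0 ≤ t) :
    ∫ s in (0 : ℝ)..t, s ^ (α - 1) * mittagLefflerNeg α α (s ^ α) =
      1 - mittagLefflerNeg α 1 (t ^ α) := by
  rcases ht.eq_or_lt with rfl | ht
  · rw [intervalIntegral.integral_same, Real.zero_rpow (by linarith),
      mittagLefflerNeg_one_eq hα.le]
    ring
  · have h := integral_sub_rpow_mul_mittagLefflerNeg hα.le hα.le one_pos ht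
    simp only [sub_self, Real.rpow_zero, one_mul, Real.Gamma_one, add_sub_cancel_right] at h
    rw [h, mittagLefflerNeg_one_eq hα.le]
    ring

theorem integral_sub_rpow_mul_mittagLefflerNeg_one {α t : ℝ} (hα : 1 < α) (ht : 0 ≤ t) :
    ∫ s in (0 : ℝ)..t, (t - s) ^ (α - 1 - 1) * mittagLefflerNeg α 1 (s ^ α) =
      Real.Gamma (α - 1) * (t ^ (α - 1) * mittagLefflerNeg α α (t ^ α)) := by
  rcases ht.eq_or_lt with rfl | ht
  · rw [intervalIntegral.integral_same, Real.zero_rpow (by linarith : α - 1 ≠ 0)]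
    ring
  · have h := integral_sub_rpow_mul_mittagLefflerNeg hα.le le_rfl (sub_pos.2 hα) ht
    simpa only [sub_self, Real.rpow_zero, one_mul, add_sub_cancel] using h

/-- `|E_{α,1}(-t ^ α)| ≤ 1`, by an energy identity and the positivity of the kernel `s ^ (α - 2)`. -/
theorem abs_mittagLefflerNeg_one_rpow_le {α t : ℝ} (hα1 : 1 < α) (hα2 : α < 2) (ht : 0 ≤ t) :
    |mittagLefflerNeg α 1 (t ^ α)| ≤ 1 := by
  let v : ℝ → ℝ := fun s => s ^ (α - 1) * mittagLefflerNeg α α (s ^ α)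
  let u : ℝ → ℝ := fun s => mittagLefflerNeg α 1 (s ^ α)
  have hu : Continuous u := (continuous_mittagLefflerNeg hα1.le le_rfl).comp
    (Real.continuous_rpow_const (by linarith))
  have hv : Continuous v := (Real.continuous_rpow_const (by linarith)).mul
    ((continuous_mittagLefflerNeg hα1.le hα1.le).comp (Real.continuous_rpow_const (by linarith)))
  let w : ℝ → ℝ := fun s => 1 - ∫ x in (0 : ℝ)..s, v x
  have hwu : ∀ s, 0 ≤ s → w s = u s := fun s hs => by
    simp only [w, v, u, integral_rpow_mul_mittagLefflerNeg hα1 hs, sub_sub_cancel]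
  have hw : ∀ s, HasDerivAt w (-v s) s := fun s =>
    ((hv.integral_hasStrictDerivAt 0 s).hasDerivAt).const_sub 1
  have hwc : Continuous w := continuous_iff_continuousAt.2 fun s => (hw s).continuousAt
  have hint : ∫ s in (0 : ℝ)..t, 2 * (w s * -v s) = w t ^ 2 - w 0 ^ 2 :=
    intervalIntegral.integral_eq_sub_of_hasDerivAt (f := fun s => w s ^ 2)
      (fun s _ => by convert! (hw s).pow 2 using 1; push_cast; ring)
      (Continuous.intervalIntegrable (by fun_prop) _ _)
  have hpos := integral_mul_rpow_convolution_nonneg hu (sub_pos.2 hα1) (by linarith) ht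
  have hG := Real.Gamma_pos_of_pos (sub_pos.2 hα1)
  have heq : ∫ s in (0 : ℝ)..t, 2 * (w s * -v s) = -(2 / Real.Gamma (α - 1)) *
      ∫ s in (0 : ℝ)..t, u s * ∫ x in (0 : ℝ)..s, (s - x) ^ (α - 1 - 1) * u x := by
    rw [← intervalIntegral.integral_const_mul]
    refine intervalIntegral.integral_congr fun s hs => ?_
    rw [Set.uIcc_of_le ht] at hs
    simp only [u, v, hwu s hs.1, integral_sub_rpow_mul_mittagLefflerNeg_one hα1 hs.1]
    field_simp
  have hw0 : w 0 = 1 := by simp [w]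
  rw [heq, hw0, hwu t ht] at hint
  have h2 : 0 ≤ 2 / Real.Gamma (α - 1) := by positivity
  have h3 : u t ^ 2 ≤ 1 := by nlinarith [mul_nonneg h2 hpos]
  exact (sq_le_one_iff_abs_le_one _).1 h3

/-- Fractional integrals of order `β ∈ (0, 1]` of bounded functions are Hölder continuous. -/
theorem abs_integral_sub_rpow_mul_sub_le {u : ℝ → ℝ} (hu : Continuous u)
    (hu1 : ∀ s, 0 ≤ s → |u s| ≤ 1) {β t h : ℝ} (hβ0 : 0 < β) (hβ1 : β ≤ 1) (ht : 0 ≤ t)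
    (hh : 0 ≤ h) :
    |(∫ s in (0 : ℝ)..(t + h), (t + h - s) ^ (β - 1) * u s) -
      ∫ s in (0 : ℝ)..t, (t - s) ^ (β - 1) * u s| ≤ 2 * (h ^ β / β) := by
  have hi : ∀ a b c : ℝ, IntervalIntegrable (fun s => (c - s) ^ (β - 1) * u s) volume a b :=
    fun a b c => (intervalIntegrable_sub_rpow hβ0 a b c).mul_continuousOn hu.continuousOn
  rw [← intervalIntegral.integral_add_adjacent_intervals (hi 0 t (t + h)) (hi t (t + h) (t + h)),
    add_sub_right_comm, ← intervalIntegral.integral_sub (hi 0 t (t + h)) (hi 0 t t)]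
  have hA : ∫ s in t..(t + h), (t + h - s) ^ (β - 1) = h ^ β / β := by
    rw [intervalIntegral.integral_comp_sub_left (fun x => x ^ (β - 1)) (t + h), sub_self,
      add_sub_cancel_left, integral_rpow (Or.inl (by linarith)), sub_add_cancel,
      Real.zero_rpow hβ0.ne', sub_zero]
  have h1 : |∫ s in t..(t + h), (t + h - s) ^ (β - 1) * u s| ≤ h ^ β / β := by
    rw [← hA, ← Real.norm_eq_abs]
    refine intervalIntegral.norm_integral_le_of_norm_le (by linarith)
      (ae_of_all _ fun s hs => ?_) (intervalIntegrable_sub_rpow hβ0 _ _ _)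
    have h0 := Real.rpow_nonneg (sub_nonneg.2 hs.2) (β - 1)
    rw [norm_mul, Real.norm_of_nonneg h0]
    exact mul_le_of_le_one_right h0 (hu1 s (ht.trans hs.1.le))
  have hB : ∫ s in (0 : ℝ)..t, ((t - s) ^ (β - 1) - (t + h - s) ^ (β - 1)) ≤ h ^ β / β := by
    rw [intervalIntegral.integral_sub (intervalIntegrable_sub_rpow hβ0 _ _ _)
      (intervalIntegrable_sub_rpow hβ0 _ _ _), integral_rpow_sub_one hβ0]
    have := intervalIntegral.integral_add_adjacent_intervals
      (intervalIntegrable_sub_rpow hβ0 0 t (t + h)) (intervalIntegrable_sub_rpow hβ0 t (t + h) (t + h))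
    rw [hA, integral_rpow_sub_one hβ0] at this
    have hmono : t ^ β / β ≤ (t + h) ^ β / β := by gcongr; linarith
    linarith
  have h2 : |∫ s in (0 : ℝ)..t, ((t + h - s) ^ (β - 1) * u s - (t - s) ^ (β - 1) * u s)| ≤
      h ^ β / β := by
    refine le_trans ?_ hB
    rw [← Real.norm_eq_abs]
    refine intervalIntegral.norm_integral_le_of_norm_le ht ?_
      ((intervalIntegrable_sub_rpow hβ0 _ _ _).sub (intervalIntegrable_sub_rpow hβ0 _ _ _))
    have hne : ∀ᵐ s : ℝ, s ≠ t := by simp [ae_iff, measure_singleton]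
    filter_upwards [hne] with s hst hs
    have hlt : 0 < t - s := sub_pos.2 (lt_of_le_of_ne hs.2 hst)
    have h0 : (t + h - s) ^ (β - 1) ≤ (t - s) ^ (β - 1) :=
      Real.rpow_le_rpow_of_nonpos hlt (by linarith) (by linarith)
    rw [← sub_mul, norm_mul, norm_sub_rev, Real.norm_of_nonneg (sub_nonneg.2 h0)]
    exact mul_le_of_le_one_right (sub_nonneg.2 h0) (hu1 s hs.1.le)
  calc _ ≤ _ := abs_add_le _ _
    _ ≤ h ^ β / β + h ^ β / β := add_le_add h2 h1
    _ = _ := by ring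

theorem abs_rpow_mul_mittagLefflerNeg_le {α t : ℝ} (hα1 : 1 < α) (hα2 : α < 2) (ht : 0 ≤ t) :
    |t ^ (α - 1) * mittagLefflerNeg α α (t ^ α)| ≤ 2 + 2 / Real.Gamma α := by
  let v : ℝ → ℝ := fun s => s ^ (α - 1) * mittagLefflerNeg α α (s ^ α)
  let u : ℝ → ℝ := fun s => mittagLefflerNeg α 1 (s ^ α)
  have hu : Continuous u := (continuous_mittagLefflerNeg hα1.le le_rfl).comp
    (Real.continuous_rpow_const (by linarith))
  have hv : Continuous v := (Real.continuous_rpow_const (by linarith)).mul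
    ((continuous_mittagLefflerNeg hα1.le hα1.le).comp (Real.continuous_rpow_const (by linarith)))
  have hu1 : ∀ s, 0 ≤ s → |u s| ≤ 1 := fun s hs => abs_mittagLefflerNeg_one_rpow_le hα1 hα2 hs
  have hβ : 0 < α - 1 := sub_pos.2 hα1
  have hG := Real.Gamma_pos_of_pos hβ
  have hGα : Real.Gamma α = (α - 1) * Real.Gamma (α - 1) := by
    rw [← Real.Gamma_add_one hβ.ne', sub_add_cancel]
  have hosc : ∀ s ∈ Set.Ioc t (t + 1), ‖v s - v t‖ ≤ 2 / Real.Gamma α := fun s hs => by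
    have h := abs_integral_sub_rpow_mul_sub_le hu hu1 hβ (by linarith) ht (sub_nonneg.2 hs.1.le)
    rw [add_sub_cancel, integral_sub_rpow_mul_mittagLefflerNeg_one hα1 ht,
      integral_sub_rpow_mul_mittagLefflerNeg_one hα1 (ht.trans hs.1.le), ← mul_sub, abs_mul,
      abs_of_pos hG] at h
    have hle : (s - t) ^ (α - 1) ≤ 1 :=
      Real.rpow_le_one (sub_nonneg.2 hs.1.le) (by linarith [hs.2]) hβ.le
    have h' : Real.Gamma (α - 1) * |v s - v t| ≤ 2 * (1 / (α - 1)) := h.trans (by gcongr)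
    rw [Real.norm_eq_abs, hGα, ← div_div, le_div_iff₀ hG, mul_comm]
    exact h'.trans_eq (by ring)
  have h1 : ‖∫ s in t..(t + 1), (v s - v t)‖ ≤ 2 / Real.Gamma α * |t + 1 - t| :=
    intervalIntegral.norm_integral_le_of_norm_le_const (by
      rwa [Set.uIoc_of_le (by linarith)])
  have h2 : ∫ s in t..(t + 1), (v s - v t) = u t - u (t + 1) - v t := by
    rw [intervalIntegral.integral_sub (hv.intervalIntegrable _ _) (by simp),
      ← intervalIntegral.integral_interval_sub_left (hv.intervalIntegrable 0 _)
        (hv.intervalIntegrable 0 _)]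
    simp only [v, u]
    rw [integral_rpow_mul_mittagLefflerNeg hα1 ht,
      integral_rpow_mul_mittagLefflerNeg hα1 (by linarith : 0 ≤ t + 1)]
    simp
  rw [h2, add_sub_cancel_left, abs_one, mul_one, Real.norm_eq_abs] at h1
  have h3 := abs_le.1 (hu1 t ht)
  have h4 := abs_le.1 (hu1 (t + 1) (by linarith))
  have h5 := abs_le.1 h1
  exact abs_le.2 ⟨by linarith, by linarith⟩

theorem exists_abs_mittagLefflerNeg_le {α β : ℝ} (hα : 1 ≤ α) (hβ : 1 ≤ β) :
    ∃ C, 0 ≤ C ∧ ∀ x ∈ Set.Icc (0 : ℝ) 1, |mittagLefflerNeg α β x| ≤ C := by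
  obtain ⟨C, hC⟩ := (isCompact_Icc (a := (0 : ℝ)) (b := 1)).exists_bound_of_continuousOn
    (continuous_mittagLefflerNeg hα hβ).continuousOn
  exact ⟨C, (norm_nonneg _).trans (hC 0 (by simp)), hC⟩

theorem exists_rpow_mul_abs_mittagLefflerNeg_le {α θ : ℝ} (hα1 : 1 < α) (hα2 : α < 2)
    (hθ1 : 1 / α < θ) (hθ2 : θ < 1) :
    ∃ C, 0 ≤ C ∧ ∀ x, 0 < x → x ^ (1 - θ) * |mittagLefflerNeg α α x| ≤ C := by
  obtain ⟨C, hC0, hC⟩ := exists_abs_mittagLefflerNeg_le hα1.le hα1.le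
  have hG := Real.Gamma_pos_of_pos (by linarith : 0 < α)
  refine ⟨C + (2 + 2 / Real.Gamma α), by positivity, fun x hx => ?_⟩
  rcases le_or_gt x 1 with hx1 | hx1
  · have h1 : x ^ (1 - θ) ≤ 1 := Real.rpow_le_one hx.le hx1 (by linarith)
    have h2 := mul_le_mul h1 (hC x ⟨hx.le, hx1⟩) (abs_nonneg _) zero_le_one
    have : 0 ≤ 2 + 2 / Real.Gamma α := by positivity
    linarith
  · have h := abs_rpow_mul_mittagLefflerNeg_le hα1 hα2 (Real.rpow_nonneg hx.le (1 / α))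
    rw [← Real.rpow_mul hx.le, ← Real.rpow_mul hx.le, one_div_mul_cancel (by linarith),
      Real.rpow_one, abs_mul, abs_of_nonneg (Real.rpow_nonneg hx.le _)] at h
    have h1 : x ^ (1 - θ) ≤ x ^ (1 / α * (α - 1)) := by
      refine Real.rpow_le_rpow_of_exponent_le hx1.le ?_
      have : 1 / α * (α - 1) = 1 - 1 / α := by field_simp
      linarith
    have h2 := mul_le_mul_of_nonneg_right h1 (abs_nonneg (mittagLefflerNeg α α x))
    linarith

theorem exists_abs_mittagLefflerNeg_one_sub_one_le {α δ : ℝ} (hα1 : 1 < α) (hα2 : α < 2)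
    (hδ0 : 0 ≤ δ) (hδ1 : δ ≤ 1) :
    ∃ C, 0 ≤ C ∧ ∀ x, 0 < x → |mittagLefflerNeg α 1 x - 1| ≤ C * x ^ δ := by
  obtain ⟨C, hC0, hC⟩ := exists_abs_mittagLefflerNeg_le hα1.le (by linarith : 1 ≤ α + 1)
  refine ⟨C + 2, by positivity, fun x hx => ?_⟩
  have hp := Real.rpow_nonneg hx.le δ
  rcases le_or_gt x 1 with hx1 | hx1
  · have h1 : x ≤ x ^ δ := by
      simpa using Real.rpow_le_rpow_of_exponent_ge hx hx1 hδ1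
    rw [mittagLefflerNeg_one_eq hα1.le, sub_sub_cancel_left, abs_neg, abs_mul, abs_of_pos hx]
    nlinarith [mul_le_mul h1 (hC x ⟨hx.le, hx1⟩) (abs_nonneg _) hp]
  · have h := abs_mittagLefflerNeg_one_rpow_le hα1 hα2 (Real.rpow_nonneg hx.le (1 / α))
    rw [← Real.rpow_mul hx.le, one_div_mul_cancel (by linarith), Real.rpow_one] at h
    have h1 : 1 ≤ x ^ δ := Real.one_le_rpow hx1.le hδ0
    have h2 : |mittagLefflerNeg α 1 x - 1| ≤ 2 := by
      have := abs_le.1 h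
      exact abs_le.2 ⟨by linarith, by linarith⟩
    nlinarith

/-- Spectral-coefficient form of `∂_t u(t,·) → u₁` in `D(A^{-θ})` as `t → 0⁺`,
for `u₀ ∈ L²(Ω)`, `u₁ ∈ D(A^{-1/α})` and `θ ∈ (1/α, 1)`. -/
theorem velocity_initial_trace (α θ : ℝ) (hα1 : 1 < α) (hα2 : α < 2)
    (hθ1 : 1 / α < θ) (hθ2 : θ < 1)
    (lam a c : ℕ → ℝ) (hlam : ∀ n, 0 < lam n)
    (ha : Summable (fun n => (a n) ^ 2))
    (hc : Summable (fun n => (lam n) ^ (-2 / α) * (c n) ^ 2)) :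
    Tendsto (fun t : ℝ => ∑' n : ℕ, (lam n) ^ (-(2 * θ)) *
        ‖((-(lam n * a n * t ^ (α - 1)) : ℝ) : ℂ) *
            mittagLeffler α α ((-(lam n * t ^ α) : ℝ) : ℂ)
          + ((c n : ℝ) : ℂ) * (mittagLeffler α 1 ((-(lam n * t ^ α) : ℝ) : ℂ) - 1)‖ ^ 2)
      (nhdsWithin 0 (Set.Ioi 0)) (nhds 0) := by
  have hα0 : 0 < α := by linarith
  have hθα : 0 < α * θ - 1 := by
    rw [div_lt_iff₀ hα0] at hθ1
    linarith
  have hinv : 0 < 1 / α := by positivity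
  obtain ⟨A, hA0, hA⟩ := exists_rpow_mul_abs_mittagLefflerNeg_le hα1 hα2 hθ1 hθ2
  obtain ⟨B, hB0, hB⟩ := exists_abs_mittagLefflerNeg_one_sub_one_le (δ := θ - 1 / α) hα1 hα2
    (by linarith) (by linarith)
  have hsum : Summable fun n => 2 * A ^ 2 * a n ^ 2 + 2 * B ^ 2 * (lam n ^ (-2 / α) * c n ^ 2) :=
    (ha.mul_left _).add (hc.mul_left _)
  have hterm : ∀ t : ℝ, 0 < t → ∀ n, (lam n) ^ (-(2 * θ)) *
        ‖((-(lam n * a n * t ^ (α - 1)) : ℝ) : ℂ) *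
            mittagLeffler α α ((-(lam n * t ^ α) : ℝ) : ℂ)
          + ((c n : ℝ) : ℂ) * (mittagLeffler α 1 ((-(lam n * t ^ α) : ℝ) : ℂ) - 1)‖ ^ 2 ≤
      (t ^ (α * θ - 1)) ^ 2 *
        (2 * A ^ 2 * a n ^ 2 + 2 * B ^ 2 * (lam n ^ (-2 / α) * c n ^ 2)) := by
    intro t ht n
    have hl := hlam n
    have htα : 0 < t ^ α := Real.rpow_pos_of_pos ht _
    have hx : 0 < lam n * t ^ α := mul_pos hl htα
    set L := lam n
    set τ := t ^ (α * θ - 1)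
    have hτ : 0 ≤ τ := Real.rpow_nonneg ht.le _
    set p := mittagLefflerNeg α α (L * t ^ α)
    set q := mittagLefflerNeg α 1 (L * t ^ α)
    have hp : L ^ (-θ) * |-(L * a n * t ^ (α - 1)) * p| ≤ τ * (A * |a n|) := by
      have e : L ^ (-θ) * |-(L * a n * t ^ (α - 1)) * p| =
          τ * ((L * t ^ α) ^ (1 - θ) * |p| * |a n|) := by
        rw [abs_mul, abs_neg, abs_mul, abs_mul, abs_of_pos hl,
          abs_of_nonneg (Real.rpow_nonneg ht.le _), Real.mul_rpow hl.le htα.le,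
          ← Real.rpow_mul ht.le, show 1 - θ = -θ + 1 by ring, Real.rpow_add hl, Real.rpow_one,
          show α - 1 = (α * θ - 1) + α * (-θ + 1) by ring, Real.rpow_add ht]
        ring
      rw [e]
      gcongr
      exact hA _ hx
    have hq : L ^ (-θ) * |c n * (q - 1)| ≤ τ * (B * (L ^ (-1 / α) * |c n|)) := by
      have e : τ * (B * (L ^ (-1 / α) * |c n|)) =
          L ^ (-θ) * (|c n| * (B * (L * t ^ α) ^ (θ - 1 / α))) := by
        rw [Real.mul_rpow hl.le htα.le, ← Real.rpow_mul ht.le,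
          show -1 / α = -θ + (θ - 1 / α) by ring, Real.rpow_add hl,
          show α * (θ - 1 / α) = α * θ - 1 by field_simp]
        ring
      rw [e, abs_mul]
      have := Real.rpow_nonneg hl.le (-θ)
      gcongr
      exact hB _ hx
    have hnorm : ‖((-(L * a n * t ^ (α - 1)) : ℝ) : ℂ) * mittagLeffler α α ((-(L * t ^ α) : ℝ) : ℂ)
          + ((c n : ℝ) : ℂ) * (mittagLeffler α 1 ((-(L * t ^ α) : ℝ) : ℂ) - 1)‖ =
        |-(L * a n * t ^ (α - 1)) * p + c n * (q - 1)| := by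
      rw [mittagLeffler_ofReal_neg, mittagLeffler_ofReal_neg, ← Real.norm_eq_abs,
        ← Complex.norm_real]
      push_cast
      rfl
    have hL2 : L ^ (-(2 * θ)) = (L ^ (-θ)) ^ 2 := by
      rw [← Real.rpow_natCast, ← Real.rpow_mul hl.le]; congr 1; push_cast; ring
    have hL3 : L ^ (-2 / α) = (L ^ (-1 / α)) ^ 2 := by
      rw [← Real.rpow_natCast, ← Real.rpow_mul hl.le]; congr 1; push_cast; ring
    have hLθ := Real.rpow_nonneg hl.le (-θ)
    rw [hnorm, hL2, hL3, ← mul_pow]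
    have hle : L ^ (-θ) * |-(L * a n * t ^ (α - 1)) * p + c n * (q - 1)| ≤
        τ * (A * |a n|) + τ * (B * (L ^ (-1 / α) * |c n|)) :=
      (mul_le_mul_of_nonneg_left (abs_add_le _ _) hLθ).trans (by rw [mul_add]; exact add_le_add hp hq)
    refine (pow_le_pow_left₀ (by positivity) hle 2).trans (add_sq_le.trans_eq ?_)
    rw [← sq_abs (a n), ← sq_abs (c n)]
    ring
  have hlim : Tendsto (fun t : ℝ => (t ^ (α * θ - 1)) ^ 2 *
      ∑' n, (2 * A ^ 2 * a n ^ 2 + 2 * B ^ 2 * (lam n ^ (-2 / α) * c n ^ 2)))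
      (nhdsWithin 0 (Set.Ioi 0)) (nhds 0) := by
    have h := (((Real.continuous_rpow_const hθα.le).tendsto 0).pow 2).mul_const
      (∑' n, (2 * A ^ 2 * a n ^ 2 + 2 * B ^ 2 * (lam n ^ (-2 / α) * c n ^ 2)))
    rw [Real.zero_rpow hθα.ne', zero_pow two_ne_zero, zero_mul] at h
    exact h.mono_left nhdsWithin_le_nhds
  have hnonneg : ∀ (t : ℝ) n, 0 ≤ (lam n) ^ (-(2 * θ)) *
        ‖((-(lam n * a n * t ^ (α - 1)) : ℝ) : ℂ) *
            mittagLeffler α α ((-(lam n * t ^ α) : ℝ) : ℂ)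
          + ((c n : ℝ) : ℂ) * (mittagLeffler α 1 ((-(lam n * t ^ α) : ℝ) : ℂ) - 1)‖ ^ 2 :=
    fun t n => mul_nonneg (Real.rpow_nonneg (hlam n).le _) (sq_nonneg _)
  refine tendsto_of_tendsto_of_tendsto_of_le_of_le' tendsto_const_nhds hlim
    (Eventually.of_forall fun t => tsum_nonneg (hnonneg t)) ?_
  filter_upwards [self_mem_nhdsWithin] with t ht
  rw [← tsum_mul_left]
  exact (Summable.of_nonneg_of_le (hnonneg t) (hterm t ht) (hsum.mul_left _)).tsum_le_tsum
    (hterm t ht) (hsum.mul_left _)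
end
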